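/- arXiv:math/0512634 — 4 statements merged into one kernel-verified Lean document; each statement's English description precedes it below -/
import Mathlib

section
/- Let (J₁, J₂) be a linear generalized Kähler structure on 𝕍 = V × V* with G = −J₁∘J₂, and let K ⊆ V* be any subspace. Then for {j, l} = {1, 2} (j ≠ l), one has Ann(K + J_l(K)) ∩ J_j(Ann(K + J_l(K))) = Ann(K + J₁(K) + J₂(K) + G(K)). (This is the real form of the identity L_j ∩ (W_K)_ℂ = L_j ∩ (U^l_K)_ℂ of Lemma 4.6 (kahler:linear), and of the displayed identity used in the generalized Kähler reduction theorem.) -/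
/-- The generalized tangent space `𝕍 = V × V*`. -/
abbrev GV (V : Type*) [AddCommGroup V] [Module ℝ V] := V × Module.Dual ℝ V

variable (V : Type*) [AddCommGroup V] [Module ℝ V] [FiniteDimensional ℝ V]

/-- The canonical symmetric pairing `⟨(X,ξ),(Y,η)⟩ = (1/2)(η X + ξ Y)` on `𝕍`. -/
noncomputable def pairForm : LinearMap.BilinForm ℝ (GV V) :=
  LinearMap.mk₂ ℝ (fun u v => (1 / 2 : ℝ) * (v.2 u.1 + u.2 v.1))
    (fun u u' v => by simp; ring)
    (fun c u v => by simp; ring)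
    (fun u v v' => by simp; ring)
    (fun c u v => by simp; ring)

/-- `V* = {0} × V*` as a subspace of `𝕍`. -/
def VStar : Submodule ℝ (GV V) := LinearMap.range (LinearMap.inr ℝ V (Module.Dual ℝ V))

variable {V}

/-- The annihilator of a subspace of `𝕍` with respect to the canonical pairing. -/
noncomputable def Ann (S : Submodule ℝ (GV V)) : Submodule ℝ (GV V) where
  carrier := {u : GV V | ∀ s ∈ S, pairForm V u s = 0}
  add_mem' := fun ha hb s hs => by simp [ha s hs, hb s hs]
  zero_mem' := fun s hs => by simp
  smul_mem' := fun c a ha s hs => by simp [ha s hs]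

/-- The image in `𝕍` of a subspace `K ⊆ V*`. -/
def ofDual (K : Submodule ℝ (Module.Dual ℝ V)) : Submodule ℝ (GV V) :=
  K.map (LinearMap.inr ℝ V (Module.Dual ℝ V))

/-- A linear generalized complex structure on `𝕍`. -/
structure IsGenCx (J : GV V →ₗ[ℝ] GV V) : Prop where
  sq : ∀ u, J (J u) = -u
  orth : ∀ u v, pairForm V (J u) (J v) = pairForm V u v

/-- A linear generalized Kähler structure on `𝕍`: two commuting linear generalized
complex structures such that `G = -J₁∘J₂` gives a positive definite form `⟨G·,·⟩`. -/
structure IsGenKahler (J₁ J₂ : GV V →ₗ[ℝ] GV V) : Prop where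
  cx1 : IsGenCx J₁
  cx2 : IsGenCx J₂
  comm : ∀ u, J₁ (J₂ u) = J₂ (J₁ u)
  posdef : ∀ u : GV V, u ≠ 0 → 0 < pairForm V (-(J₁ (J₂ u))) u

theorem mem_Ann {V : Type*} [AddCommGroup V] [Module ℝ V] {S : Submodule ℝ (GV V)} {u : GV V} :
    u ∈ Ann S ↔ ∀ s ∈ S, pairForm V u s = 0 := Iff.rfl

theorem Ann_sup {V : Type*} [AddCommGroup V] [Module ℝ V] (S T : Submodule ℝ (GV V)) :
    Ann (S ⊔ T) = Ann S ⊓ Ann T := by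
  ext u
  simp only [Submodule.mem_inf, mem_Ann]
  refine ⟨fun h => ⟨fun s hs => h s (Submodule.mem_sup_left hs),
    fun s hs => h s (Submodule.mem_sup_right hs)⟩, fun ⟨hS, hT⟩ s hs => ?_⟩
  obtain ⟨a, ha, b, hb, rfl⟩ := Submodule.mem_sup.mp hs
  rw [map_add, hS a ha, hT b hb, add_zero]

/-- A linear generalized complex structure carries annihilators to annihilators. -/
theorem IsGenCx.map_Ann {V : Type*} [AddCommGroup V] [Module ℝ V] {J : GV V →ₗ[ℝ] GV V}
    (hJ : IsGenCx J) (S : Submodule ℝ (GV V)) : (Ann S).map J = Ann (S.map J) := by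
  ext u
  constructor
  · rintro ⟨v, hv, rfl⟩ _ ⟨s, hs, rfl⟩
    rw [hJ.orth]
    exact hv s hs
  · intro hu
    refine ⟨-J u, fun s hs => ?_, by rw [map_neg, hJ.sq, neg_neg]⟩
    rw [← hJ.orth, map_neg, hJ.sq, neg_neg]
    exact hu _ ⟨s, hs, rfl⟩

/-- Lemma kahler:linear, real form of `L_j ∩ (W_K)_ℂ = L_j ∩ (U^l_K)_ℂ`:
for a linear generalized Kähler structure `(J₁, J₂)` with `G = -J₁∘J₂` and any `K ⊆ V*`,
`Ann(K + J_l K) ∩ J_j(Ann(K + J_l K)) = Ann(K + J₁K + J₂K + GK)` for `{j,l} = {1,2}`. -/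
theorem statement0 {V : Type*} [AddCommGroup V] [Module ℝ V] [FiniteDimensional ℝ V]
    (J₁ J₂ : GV V →ₗ[ℝ] GV V) (h : IsGenKahler J₁ J₂)
    (K : Submodule ℝ (Module.Dual ℝ V)) :
    let G : GV V →ₗ[ℝ] GV V := -(J₁ ∘ₗ J₂)
    let Kv : Submodule ℝ (GV V) := ofDual K
    let W : Submodule ℝ (GV V) := Ann (Kv ⊔ Kv.map J₁ ⊔ Kv.map J₂ ⊔ Kv.map G)
    Ann (Kv ⊔ Kv.map J₂) ⊓ (Ann (Kv ⊔ Kv.map J₂)).map J₁ = W ∧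
    Ann (Kv ⊔ Kv.map J₁) ⊓ (Ann (Kv ⊔ Kv.map J₁)).map J₂ = W := by
  intro G Kv W
  have hG : Kv.map G = (Kv.map J₂).map J₁ := by
    rw [← Submodule.map_comp]
    exact Submodule.map_neg _ _
  have hG' : Kv.map G = (Kv.map J₁).map J₂ := by
    rw [hG, ← Submodule.map_comp, ← Submodule.map_comp]
    exact congrArg (Kv.map ·) (LinearMap.ext h.comm)
  constructor
  · rw [h.cx1.map_Ann, ← Ann_sup, Submodule.map_sup, ← hG]
    exact congrArg Ann (by ac_rfl)
  · rw [h.cx2.map_Ann, ← Ann_sup, Submodule.map_sup, ← hG']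
    exact congrArg Ann (by ac_rfl)
end

section
/- Let (J₁, J₂) be a linear generalized Kähler structure on 𝕍 = V × V* with G = −J₁∘J₂, let K ⊆ V* be a subspace, and set U¹_K = Ann(K + J₁(K)) and W_K = Ann(K + J₁(K) + J₂(K) + G(K)). Assume (1) K + J₁(K) ⊆ U¹_K and (2) J₁(K) ∩ V* = {0}. Then K ∩ J₁(K) = {0}, W_K ∩ (K + J₁(K)) = {0}, and U¹_K = W_K ⊕ (K ⊕ J₁(K)) as an internal direct sum; consequently the composite of the inclusion W_K ↪ U¹_K with the quotient map U¹_K → U¹_K/(K + J₁(K)) is a linear isomorphism. (Direct-sum refinement of Lemma kahler:linear and the natural isomorphism of Lemma kahler:sequence.) -/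
variable (V : Type*) [AddCommGroup V] [Module ℝ V] [FiniteDimensional ℝ V]

variable {V}

theorem pairForm_comm {V : Type*} [AddCommGroup V] [Module ℝ V]
    (u v : GV V) : pairForm V u v = pairForm V v u := by
  simp [pairForm, add_comm]

theorem Ann_anti {V : Type*} [AddCommGroup V] [Module ℝ V]
    {S T : Submodule ℝ (GV V)} (hST : S ≤ T) : Ann T ≤ Ann S :=
  fun _ hu s hs => hu s (hST hs)

namespace IsGenKahler

variable {V : Type*} [AddCommGroup V] [Module ℝ V]
  {J₁ J₂ : GV V →ₗ[ℝ] GV V}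

/-- The operator `G = -J₁∘J₂` is self-adjoint for the canonical pairing. -/
theorem pairForm_G_left (h : IsGenKahler J₁ J₂) (u v : GV V) :
    pairForm V ((-(J₁ ∘ₗ J₂)) u) v = pairForm V u ((-(J₁ ∘ₗ J₂)) v) := by
  have h1 := h.cx1.orth (J₁ (J₂ u)) v
  have h2 := h.cx2.orth (J₂ u) (J₁ v)
  rw [h.cx1.sq] at h1
  rw [h.cx2.sq, ← h.comm] at h2
  simp only [map_neg, LinearMap.neg_apply, LinearMap.comp_apply] at *
  linarith

/-- The image of `S + J₁ S` under `G = -J₁∘J₂` is `J₂ S + G S`. -/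
theorem map_G_sup (h : IsGenKahler J₁ J₂) (S : Submodule ℝ (GV V)) :
    (S ⊔ S.map J₁).map (-(J₁ ∘ₗ J₂)) = S.map J₂ ⊔ S.map (-(J₁ ∘ₗ J₂)) := by
  have hc : (-(J₁ ∘ₗ J₂)) ∘ₗ J₁ = J₂ := by
    refine LinearMap.ext fun u => ?_
    simp only [LinearMap.neg_apply, LinearMap.comp_apply]
    rw [← h.comm, h.cx1.sq, neg_neg]
  rw [Submodule.map_sup, ← Submodule.map_comp, hc, sup_comm]

theorem Ann_map_G_inf (h : IsGenKahler J₁ J₂) (L : Submodule ℝ (GV V)) :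
    Ann (L.map (-(J₁ ∘ₗ J₂))) ⊓ L = ⊥ := by
  refine (Submodule.eq_bot_iff _).2 fun u hu => ?_
  by_contra hne
  have hpos := h.posdef u hne
  have h0 := hu.1 _ (Submodule.mem_map_of_mem hu.2)
  rw [pairForm_comm] at h0
  exact hpos.ne' h0

theorem Ann_map_G_sup [FiniteDimensional ℝ V] (h : IsGenKahler J₁ J₂) (L : Submodule ℝ (GV V)) :
    Ann (L.map (-(J₁ ∘ₗ J₂))) ⊔ L = ⊤ := by
  let g : LinearMap.BilinForm ℝ (GV V) := (pairForm V).comp (-(J₁ ∘ₗ J₂)) LinearMap.id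
  have hg : g.IsRefl := fun u v huv => by
    change pairForm V ((-(J₁ ∘ₗ J₂)) v) u = 0
    rw [h.pairForm_G_left, pairForm_comm]
    exact huv
  have horth : g.orthogonal L = Ann (L.map (-(J₁ ∘ₗ J₂))) := by
    ext u
    simp only [LinearMap.BilinForm.mem_orthogonal_iff, mem_Ann, Submodule.mem_map,
      forall_exists_index, and_imp, forall_apply_eq_imp_iff₂]
    refine forall₂_congr fun n _ => ?_
    rw [pairForm_comm]
    rfl
  have hdisj : Disjoint L (g.orthogonal L) := by
    rw [horth, disjoint_comm, disjoint_iff]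
    exact h.Ann_map_G_inf L
  have hcompl := (LinearMap.BilinForm.isCompl_orthogonal_iff_disjoint hg).2 hdisj
  rw [← horth, sup_comm]
  exact hcompl.sup_eq_top

end IsGenKahler

theorem bijective_mkQ_comp_inclusion {R M : Type*} [Ring R] [AddCommGroup M] [Module R M]
    {U W L : Submodule R M} (hinf : W ⊓ L = ⊥) (hsup : U = W ⊔ L) (hWU : W ≤ U) :
    Function.Bijective ((L.comap U.subtype).mkQ.comp (Submodule.inclusion hWU)) := by
  constructor
  · rw [← LinearMap.ker_eq_bot, Submodule.eq_bot_iff]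
    intro w hw
    have hwL : (w : M) ∈ L := by
      simpa using hw
    have : (w : M) ∈ W ⊓ L := ⟨w.2, hwL⟩
    rw [hinf, Submodule.mem_bot] at this
    exact Subtype.ext this
  · intro q
    obtain ⟨u, rfl⟩ := Submodule.mkQ_surjective _ q
    have hu : (u : M) ∈ W ⊔ L := hsup ▸ u.2
    obtain ⟨w, hw, l, hl, hwl⟩ := Submodule.mem_sup.1 hu
    refine ⟨⟨w, hw⟩, ?_⟩
    rw [LinearMap.comp_apply, Submodule.mkQ_apply, Submodule.mkQ_apply, eq_comm,
      Submodule.Quotient.eq]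
    change (u : M) - w ∈ L
    rw [← hwl, add_sub_cancel_left]
    exact hl

set_option maxSynthPendingDepth 3 in
/-- direct-sum refinement of Lemma kahler:linear and the natural
isomorphism of Lemma kahler:sequence: under (1) `K + J₁K ⊆ U¹_K` and (2)
`J₁(K) ∩ V* = 0`, one has `K ∩ J₁K = 0`, `W_K ∩ (K + J₁K) = 0`,
`U¹_K = W_K ⊕ (K ⊕ J₁K)`, and the composite `W_K ↪ U¹_K → U¹_K/(K + J₁K)` is
a linear isomorphism. -/
theorem statement2 {V : Type*} [AddCommGroup V] [Module ℝ V] [FiniteDimensional ℝ V]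
    (J₁ J₂ : GV V →ₗ[ℝ] GV V) (h : IsGenKahler J₁ J₂)
    (K : Submodule ℝ (Module.Dual ℝ V))
    (hK : ofDual K ⊔ (ofDual K).map J₁ ≤ Ann (ofDual K ⊔ (ofDual K).map J₁))
    (hV : (ofDual K).map J₁ ⊓ VStar V = ⊥) :
    let U : Submodule ℝ (GV V) := Ann (ofDual K ⊔ (ofDual K).map J₁)
    let W : Submodule ℝ (GV V) :=
      Ann (ofDual K ⊔ (ofDual K).map J₁ ⊔ (ofDual K).map J₂
            ⊔ (ofDual K).map (-(J₁ ∘ₗ J₂)))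
    let KU : Submodule ℝ U := (ofDual K ⊔ (ofDual K).map J₁).comap U.subtype
    ofDual K ⊓ (ofDual K).map J₁ = ⊥ ∧
    W ⊓ (ofDual K ⊔ (ofDual K).map J₁) = ⊥ ∧
    U = W ⊔ (ofDual K ⊔ (ofDual K).map J₁) ∧
    ∀ hWU : W ≤ U,
      Function.Bijective
        ((KU.mkQ.comp (Submodule.inclusion hWU) : ↥W →ₗ[ℝ] (↥U ⧸ KU))) := by
  intro U W KU
  set L := ofDual K ⊔ (ofDual K).map J₁ with hL
  have hWdef : W = Ann (L ⊔ L.map (-(J₁ ∘ₗ J₂))) := by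
    rw [hL, h.map_G_sup, ← sup_assoc]
  have hinf : W ⊓ L = ⊥ := by
    rw [hWdef, eq_bot_iff, ← h.Ann_map_G_inf L]
    exact inf_le_inf_right _ (Ann_anti le_sup_right)
  have hsup : U = W ⊔ L := by
    refine le_antisymm (fun u hu => ?_) (sup_le ?_ hK)
    · have hu' : u ∈ Ann (L.map (-(J₁ ∘ₗ J₂))) ⊔ L := by
        rw [h.Ann_map_G_sup L]
        exact Submodule.mem_top
      obtain ⟨b, hb, a, ha, rfl⟩ := Submodule.mem_sup.1 hu'
      have hbU : b ∈ U := by simpa using U.sub_mem hu (hK ha)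
      refine Submodule.add_mem_sup ?_ ha
      rw [hWdef, mem_Ann]
      intro s hs
      obtain ⟨x, hx, y, hy, rfl⟩ := Submodule.mem_sup.1 hs
      rw [map_add, hbU x hx, hb y hy, add_zero]
    · rw [hWdef]
      exact Ann_anti le_sup_left
  refine ⟨?_, hinf, hsup, fun hWU => bijective_mkQ_comp_inclusion hinf hsup hWU⟩
  rw [eq_bot_iff, ← hV, inf_comm]
  exact inf_le_inf_left _ LinearMap.map_le_range
end

section
/- Let K ⊆ V* and K' ⊆ 𝕍 = V × V* be subspaces with K' ∩ V* = {0}, K ⊆ Ann(K + K'), and such that the restriction of ⟨,⟩ to K' is nondegenerate; set N' = a(K'). Then K ⊆ Ann_{V*}(N') ⊆ Ann(K + K'), the projection a induces a well-defined surjective linear map from 𝕍'_K = Ann(K + K')/K onto Ann_V(K), and the kernel of this map equals the image of Ann_{V*}(N') under the quotient map Ann(K + K') → Ann(K + K')/K, i.e. there is an exact sequence 0 → Ann_{V*}(N')/K → 𝕍'_K → Ann_V(K) → 0. (Lemma courant:missingrank.) -/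
variable (V : Type*) [AddCommGroup V] [Module ℝ V] [FiniteDimensional ℝ V]

variable {V}

theorem pairForm_eq_zero_iff {V : Type*} [AddCommGroup V] [Module ℝ V]
    (u v : GV V) : pairForm V u v = 0 ↔ v.2 u.1 + u.2 v.1 = 0 := by
  simp [pairForm]

theorem mem_Ann_ofDual_sup_iff {V : Type*} [AddCommGroup V] [Module ℝ V]
    (K : Submodule ℝ (Module.Dual ℝ V)) (K' : Submodule ℝ (GV V)) (w : GV V) :
    w ∈ Ann (ofDual K ⊔ K') ↔ (∀ k ∈ K, k w.1 = 0) ∧ ∀ s ∈ K', s.2 w.1 + w.2 s.1 = 0 := by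
  constructor
  · intro h
    refine ⟨fun k hk => ?_, fun s hs => ?_⟩
    · have h0 := h (0, k) (Submodule.mem_sup_left ⟨k, hk, rfl⟩)
      simpa [pairForm_eq_zero_iff] using h0
    · exact (pairForm_eq_zero_iff w s).1 (h s (Submodule.mem_sup_right hs))
  · rintro ⟨h₁, h₂⟩ s hs
    obtain ⟨_, ⟨k, hk, rfl⟩, t, ht, rfl⟩ := Submodule.mem_sup.1 hs
    rw [map_add, (pairForm_eq_zero_iff w t).2 (h₂ t ht), add_zero, pairForm_eq_zero_iff]
    simpa using h₁ k hk

/-- A subspace of `𝕍` meeting `V*` trivially projects injectively to `V`, so every functional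
on it is induced by an element of `V*`. -/
theorem exists_dual_comp_fst_eq {V : Type*} [AddCommGroup V] [Module ℝ V]
    {K' : Submodule ℝ (GV V)} (hKV : K' ⊓ VStar V = ⊥) (φ : Module.Dual ℝ K') :
    ∃ ξ : Module.Dual ℝ V, ∀ s : K', ξ (s : GV V).1 = φ s := by
  let f : K' →ₗ[ℝ] V := LinearMap.fst ℝ V (Module.Dual ℝ V) ∘ₗ K'.subtype
  have hf : LinearMap.ker f = ⊥ := by
    rw [LinearMap.ker_eq_bot']
    intro s hs
    have hmem : (s : GV V) ∈ K' ⊓ VStar V := ⟨s.2, (s : GV V).2, Prod.ext hs.symm rfl⟩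
    rw [hKV, Submodule.mem_bot] at hmem
    exact Subtype.ext hmem
  obtain ⟨g, hg⟩ :=
    LinearMap.exists_leftInverse_of_injective (K := ℝ) (V := K') (V' := V) f hf
  exact ⟨φ ∘ₗ g, fun s => congrArg φ (LinearMap.congr_fun hg s)⟩

/-- Lemma courant:missingrank: if `K' ∩ V* = 0`,
`K ⊆ Ann(K + K')` and `⟨,⟩` restricts nondegenerately to `K'`, then with
`N' = a(K')`: `K ⊆ Ann_{V*}(N') ⊆ Ann(K + K')`, the projection `a` induces a
well-defined surjection `𝕍'_K = Ann(K + K')/K → Ann_V(K)` whose kernel is the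
image of `Ann_{V*}(N')`, i.e. `0 → Ann_{V*}(N')/K → 𝕍'_K → Ann_V(K) → 0` is exact. -/
theorem statement13 {V : Type*} [AddCommGroup V] [Module ℝ V] [FiniteDimensional ℝ V]
    (K : Submodule ℝ (Module.Dual ℝ V)) (K' : Submodule ℝ (GV V))
    (hKV : K' ⊓ VStar V = ⊥)
    (hK : ofDual K ≤ Ann (ofDual K ⊔ K'))
    (hnd : ∀ x ∈ K', (∀ y ∈ K', pairForm V x y = 0) → x = 0) :
    let A : Submodule ℝ (GV V) := Ann (ofDual K ⊔ K')
    let N' : Submodule ℝ V := K'.map (LinearMap.fst ℝ V (Module.Dual ℝ V))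
    K ≤ N'.dualAnnihilator ∧
    ofDual N'.dualAnnihilator ≤ A ∧
    (∀ x ∈ A, (x : GV V).1 ∈ K.dualCoannihilator) ∧
    (∀ X ∈ K.dualCoannihilator, ∃ w ∈ A, (w : GV V).1 = X) ∧
    (∀ x ∈ A, (x : GV V).1 = 0 → (x : GV V).2 ∈ N'.dualAnnihilator) := by
  intro A N'
  have mem_N' : ∀ ξ : Module.Dual ℝ V,
      ξ ∈ N'.dualAnnihilator ↔ ∀ s ∈ K', ξ (s : GV V).1 = 0 := fun ξ => by
    simp only [N', Submodule.mem_dualAnnihilator, Submodule.mem_map, forall_exists_index,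
      and_imp, forall_apply_eq_imp_iff₂, LinearMap.fst_apply]
  refine ⟨fun k hk => ?_, ?_, fun x hx => ?_, fun X hX => ?_, fun x hx hx₁ => ?_⟩
  · have h := ((mem_Ann_ofDual_sup_iff K K' _).1 (hK ⟨k, hk, rfl⟩)).2
    exact (mem_N' k).2 fun s hs => by simpa using h s hs
  · rintro _ ⟨ξ, hξ, rfl⟩
    refine (mem_Ann_ofDual_sup_iff K K' _).2 ⟨fun k _ => by simp, fun s hs => ?_⟩
    simpa using (mem_N' ξ).1 hξ s hs
  · exact (Submodule.mem_dualCoannihilator _).2 ((mem_Ann_ofDual_sup_iff K K' x).1 hx).1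
  · obtain ⟨ξ, hξ⟩ := exists_dual_comp_fst_eq hKV
      (-(Module.Dual.eval ℝ V X ∘ₗ LinearMap.snd ℝ V (Module.Dual ℝ V) ∘ₗ K'.subtype))
    refine ⟨(X, ξ), (mem_Ann_ofDual_sup_iff K K' _).2
      ⟨(Submodule.mem_dualCoannihilator _).1 hX, fun s hs => ?_⟩, rfl⟩
    simp [hξ ⟨s, hs⟩]
  · refine (mem_N' x.2).2 fun s hs => ?_
    simpa [hx₁] using ((mem_Ann_ofDual_sup_iff K K' x).1 hx).2 s hs
end

section
/- Let (J₁, J₂) be a linear generalized Kähler structure on 𝕍 = V × V* with G = −J₁∘J₂, let K ⊆ V* be a subspace, and set N_j = a(J_j(K)) for j = 1, 2. Assume for j = 1, 2: (1) K + J_j(K) ⊆ Ann(K + J_j(K)); (2) J_j(K) ∩ V* = {0}; and (3) N₁ ∩ N₂ = {0}. Then J₁(K) ∩ J₂(K) = {0}, (J₁(K) + J₂(K)) ∩ V* = {0}, N₁ + N₂ ⊆ Ann_V(K), and the projection a induces a well-defined surjective linear map from Ann(K + J₁(K) + J₂(K))/K onto Ann_V(K) whose kernel equals the image of Ann_{V*}(N₁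 + N₂) under the quotient map; i.e. there is an exact sequence 0 → Ann_{V*}(N₁ + N₂)/K → Ann(K + J₁(K) + J₂(K))/K → Ann_V(K) → 0. (Lemma double:linear.) -/
variable (V : Type*) [AddCommGroup V] [Module ℝ V] [FiniteDimensional ℝ V]

variable {V}

theorem mem_Ann_iff {V : Type*} [AddCommGroup V] [Module ℝ V] (S : Submodule ℝ (GV V))
    (u : GV V) : u ∈ Ann S ↔ ∀ s ∈ S, s.2 u.1 + u.2 s.1 = 0 := by
  simp only [← pairForm_eq_zero_iff]
  rfl

theorem mem_VStar_iff {V : Type*} [AddCommGroup V] [Module ℝ V] (u : GV V) :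
    u ∈ VStar V ↔ u.1 = 0 := by
  simp [VStar, LinearMap.range_inr]

theorem mem_Ann_ofDual_iff {V : Type*} [AddCommGroup V] [Module ℝ V]
    (K : Submodule ℝ (Module.Dual ℝ V)) (u : GV V) :
    u ∈ Ann (ofDual K) ↔ u.1 ∈ K.dualCoannihilator := by
  rw [mem_Ann_iff, Submodule.mem_dualCoannihilator]
  refine ⟨fun h φ hφ => ?_, ?_⟩
  · simpa using h _ (Submodule.mem_map_of_mem hφ)
  · rintro h _ ⟨φ, hφ, rfl⟩
    simpa using h φ hφ

/-- An element of `V*` annihilates `S` exactly when it vanishes on the projection of `S`. -/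
theorem mem_Ann_iff_of_fst_eq_zero {V : Type*} [AddCommGroup V] [Module ℝ V]
    (S : Submodule ℝ (GV V)) {u : GV V} (hu : u.1 = 0) :
    u ∈ Ann S ↔ u.2 ∈ (S.map (LinearMap.fst ℝ V (Module.Dual ℝ V))).dualAnnihilator := by
  simp [mem_Ann_iff, Submodule.mem_dualAnnihilator, hu]

/-- A linear functional on `E` factors, on a subspace `W` where `p` is injective, through `p`. -/
theorem exists_dual_comp_eq_on {k E F : Type*} [Field k] [AddCommGroup E] [Module k E]
    [AddCommGroup F] [Module k F] {W : Submodule k E} (p : E →ₗ[k] F)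
    (hW : W ⊓ LinearMap.ker p = ⊥) (φ : Module.Dual k E) :
    ∃ ξ : Module.Dual k F, ∀ w ∈ W, ξ (p w) = φ w := by
  have hker : LinearMap.ker (p ∘ₗ W.subtype) = ⊥ := by
    refine LinearMap.ker_eq_bot'.2 fun w hw => ?_
    have hmem : (w : E) ∈ W ⊓ LinearMap.ker p := ⟨w.2, hw⟩
    rw [hW, Submodule.mem_bot] at hmem
    exact Subtype.ext hmem
  obtain ⟨g, hg⟩ := (p ∘ₗ W.subtype).exists_leftInverse_of_injective hker
  refine ⟨φ ∘ₗ W.subtype ∘ₗ g, fun w hw => ?_⟩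
  have hgw : g (p w) = ⟨w, hw⟩ := LinearMap.congr_fun hg ⟨w, hw⟩
  simp [hgw]

/-- If `W` meets `V*` trivially, then `Ann W` projects onto `V`. -/
theorem exists_mem_Ann_fst_eq {V : Type*} [AddCommGroup V] [Module ℝ V]
    {W : Submodule ℝ (GV V)} (hW : W ⊓ VStar V = ⊥) (X : V) : ∃ w ∈ Ann W, w.1 = X := by
  rw [VStar, LinearMap.range_inr] at hW
  obtain ⟨ξ, hξ⟩ := exists_dual_comp_eq_on (LinearMap.fst ℝ V (Module.Dual ℝ V)) hW
    (-(Module.Dual.eval ℝ V X ∘ₗ LinearMap.snd ℝ V (Module.Dual ℝ V)))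
  refine ⟨(X, ξ), (mem_Ann_iff _ _).2 fun w hw => ?_, rfl⟩
  have hξw : ξ w.1 = -w.2 X := hξ w hw
  simp [hξw]

/-- If `S` and `T` meet `V*` trivially and have independent projections to `V`, then
`S ⊔ T` meets `V*` trivially. -/
theorem sup_inf_VStar_eq_bot {V : Type*} [AddCommGroup V] [Module ℝ V]
    {S T : Submodule ℝ (GV V)} (hS : S ⊓ VStar V = ⊥) (hT : T ⊓ VStar V = ⊥)
    (hST : S.map (LinearMap.fst ℝ V (Module.Dual ℝ V)) ⊓
      T.map (LinearMap.fst ℝ V (Module.Dual ℝ V)) = ⊥) :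
    (S ⊔ T) ⊓ VStar V = ⊥ := by
  rw [eq_bot_iff]
  rintro x ⟨hx, hxV⟩
  obtain ⟨s, hs, t, ht, rfl⟩ := Submodule.mem_sup.1 hx
  have hsum : s.1 + t.1 = 0 := (mem_VStar_iff _).1 hxV
  have hs0 : s.1 = 0 := by
    have hmem : s.1 ∈ S.map (LinearMap.fst ℝ V (Module.Dual ℝ V)) ⊓
        T.map (LinearMap.fst ℝ V (Module.Dual ℝ V)) :=
      ⟨⟨s, hs, rfl⟩, ⟨-t, T.neg_mem ht, (eq_neg_of_add_eq_zero_left hsum).symm⟩⟩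
    rwa [hST, Submodule.mem_bot] at hmem
  have ht0 : t.1 = 0 := by rwa [hs0, zero_add] at hsum
  have hs' : s ∈ S ⊓ VStar V := ⟨hs, (mem_VStar_iff s).2 hs0⟩
  have ht' : t ∈ T ⊓ VStar V := ⟨ht, (mem_VStar_iff t).2 ht0⟩
  rw [hS, Submodule.mem_bot] at hs'
  rw [hT, Submodule.mem_bot] at ht'
  simp [hs', ht']

/-- If `S` meets `V*` trivially, and `S`, `T` have independent projections to `V`, then
`S` and `T` are independent. -/
theorem inf_eq_bot_of_map_fst_inf_eq_bot {V : Type*} [AddCommGroup V] [Module ℝ V]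
    {S T : Submodule ℝ (GV V)} (hS : S ⊓ VStar V = ⊥)
    (hST : S.map (LinearMap.fst ℝ V (Module.Dual ℝ V)) ⊓
      T.map (LinearMap.fst ℝ V (Module.Dual ℝ V)) = ⊥) :
    S ⊓ T = ⊥ := by
  rw [eq_bot_iff, ← hS]
  rintro x ⟨hxS, hxT⟩
  refine ⟨hxS, (mem_VStar_iff x).2 ?_⟩
  rw [← Submodule.mem_bot ℝ, ← hST]
  exact ⟨⟨x, hxS, rfl⟩, ⟨x, hxT, rfl⟩⟩

/-- If `ofDual K ⊔ S` is isotropic, then `S` projects into the annihilator of `K`. -/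
theorem map_fst_le_dualCoannihilator {V : Type*} [AddCommGroup V] [Module ℝ V]
    {K : Submodule ℝ (Module.Dual ℝ V)} {S : Submodule ℝ (GV V)}
    (h : ofDual K ⊔ S ≤ Ann (ofDual K ⊔ S)) :
    S.map (LinearMap.fst ℝ V (Module.Dual ℝ V)) ≤ K.dualCoannihilator := by
  rw [Ann_sup] at h
  rintro _ ⟨s, hs, rfl⟩
  exact (mem_Ann_ofDual_iff K s).1 (h (le_sup_right (a := ofDual K) hs)).1

/-- Lemma double:linear: under the assumptions (1), (2) for
`j = 1,2` and (3) `N₁ ∩ N₂ = 0`, one has `J₁K ∩ J₂K = 0`,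
`(J₁K + J₂K) ∩ V* = 0`, `N₁ + N₂ ⊆ Ann_V(K)`, and an exact sequence
`0 → Ann_{V*}(N₁ + N₂)/K → Ann(K + J₁K + J₂K)/K → Ann_V(K) → 0`. -/
theorem statement14 {V : Type*} [AddCommGroup V] [Module ℝ V] [FiniteDimensional ℝ V]
    (J₁ J₂ : GV V →ₗ[ℝ] GV V) (h : IsGenKahler J₁ J₂)
    (K : Submodule ℝ (Module.Dual ℝ V))
    (h1 : ofDual K ⊔ (ofDual K).map J₁ ≤ Ann (ofDual K ⊔ (ofDual K).map J₁))
    (h1' : ofDual K ⊔ (ofDual K).map J₂ ≤ Ann (ofDual K ⊔ (ofDual K).map J₂))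
    (h2 : (ofDual K).map J₁ ⊓ VStar V = ⊥)
    (h2' : (ofDual K).map J₂ ⊓ VStar V = ⊥)
    (h3 : ((ofDual K).map J₁).map (LinearMap.fst ℝ V (Module.Dual ℝ V)) ⊓
          ((ofDual K).map J₂).map (LinearMap.fst ℝ V (Module.Dual ℝ V)) = ⊥) :
    let Kv : Submodule ℝ (GV V) := ofDual K
    let N₁ : Submodule ℝ V := (Kv.map J₁).map (LinearMap.fst ℝ V (Module.Dual ℝ V))
    let N₂ : Submodule ℝ V := (Kv.map J₂).map (LinearMap.fst ℝ V (Module.Dual ℝ V))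
    let A : Submodule ℝ (GV V) := Ann (Kv ⊔ Kv.map J₁ ⊔ Kv.map J₂)
    Kv.map J₁ ⊓ Kv.map J₂ = ⊥ ∧
    (Kv.map J₁ ⊔ Kv.map J₂) ⊓ VStar V = ⊥ ∧
    N₁ ⊔ N₂ ≤ K.dualCoannihilator ∧
    (∀ x ∈ A, (x : GV V).1 ∈ K.dualCoannihilator) ∧
    (∀ X ∈ K.dualCoannihilator, ∃ w ∈ A, (w : GV V).1 = X) ∧
    ofDual (N₁ ⊔ N₂).dualAnnihilator ≤ A ∧
    (∀ x ∈ A, (x : GV V).1 = 0 → (x : GV V).2 ∈ (N₁ ⊔ N₂).dualAnnihilator) := by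
  intro Kv N₁ N₂ A
  have hW := sup_inf_VStar_eq_bot h2 h2' h3
  have hN : (Kv.map J₁ ⊔ Kv.map J₂).map (LinearMap.fst ℝ V (Module.Dual ℝ V)) = N₁ ⊔ N₂ :=
    Submodule.map_sup _ _ _
  have hA (x : GV V) :
      x ∈ A ↔ x.1 ∈ K.dualCoannihilator ∧ x ∈ Ann (Kv.map J₁ ⊔ Kv.map J₂) := by
    rw [← mem_Ann_ofDual_iff, ← Submodule.mem_inf, ← Ann_sup, ← sup_assoc]
  refine ⟨inf_eq_bot_of_map_fst_inf_eq_bot h2 h3, hW,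
    sup_le (map_fst_le_dualCoannihilator h1) (map_fst_le_dualCoannihilator h1'),
    fun x hx => ((hA x).1 hx).1, fun X hX => ?_, ?_, fun x hx hx0 => ?_⟩
  · obtain ⟨w, hw, rfl⟩ := exists_mem_Ann_fst_eq hW X
    exact ⟨w, (hA w).2 ⟨hX, hw⟩, rfl⟩
  · rintro _ ⟨ξ, hξ, rfl⟩
    refine (hA _).2 ⟨Submodule.zero_mem _, (mem_Ann_iff_of_fst_eq_zero _ rfl).2 ?_⟩
    rw [hN]
    exact hξ
  · rw [← hN]
    exact (mem_Ann_iff_of_fst_eq_zero _ hx0).1 ((hA x).1 hx).2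
end
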